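/- Let γ > 1/4 and define s(x) = 1 + |x| − x₁ for x ∈ ℝ³. Define c = γ − 1/2 if γ ∈ (1/4, 2] and c = 3/2 if γ > 2; d = γ if γ ∈ (1/4, 3/2] and d = 3/2 if γ > 3/2; k = 1 if γ = 2 and k = 0 otherwise. Then there is a constant C(γ) > 0 such that for all x ∈ ℝ³: ∫_{ℝ³} [(1+|x−y|) s(x−y)]^{−3/2} [(1+|y|) s(y)]^{−γ} dy ≤ C(γ) (1+|x|)^{−c} s(x)^{−d} ln^k(2+|x|). -/

import Mathlib

open MeasureTheory

noncomputable def sOne (x : EuclideanSpace ℝ (Fin 3)) : ℝ := 1 + ‖x‖ - x 0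

open Set
open scoped ENNReal

/-- The anisotropic Oseen weight `(1 + |x|) s(x)`. -/
noncomputable def wakeWeight (x : EuclideanSpace ℝ (Fin 3)) : ℝ := (1 + ‖x‖) * sOne x

theorem measurePreserving_euclidean_three :
    MeasurePreserving (fun z : EuclideanSpace ℝ (Fin 3) ↦ (z 0, (z 1, z 2))) := by
  have h1 := PiLp.volume_preserving_ofLp (Fin 3)
  have h2 := volume_preserving_piFinSuccAbove (fun _ : Fin 3 ↦ ℝ) 0
  have h3 := (MeasurePreserving.id (volume : Measure ℝ)).prod (volume_preserving_finTwoArrow ℝ)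
  exact h3.comp (h2.comp h1)

theorem lintegral_scaled_bracket_le :
    ∃ K : ℝ, 0 < K ∧ ∀ A : ℝ, 0 < A →
      ∫⁻ u : ℝ, ENNReal.ofReal ((A + u ^ 2) ^ (-(3:ℝ)/4)) = ENNReal.ofReal (K * A ^ (-(1:ℝ)/4)) := by
  have hint : Integrable (fun u : ℝ ↦ (1 + u ^ 2) ^ (-(3:ℝ)/4)) := by
    have := integrable_rpow_neg_one_add_norm_sq (E := ℝ) (μ := volume) (r := 3/2) (by norm_num)
    convert this using 3
    · simp
    · norm_num
  have hpos : ∀ u : ℝ, 0 ≤ (1 + u ^ 2) ^ (-(3:ℝ)/4) := fun u ↦ by positivity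
  refine ⟨∫ u : ℝ, (1 + u ^ 2) ^ (-(3:ℝ)/4), ?_, fun A hA ↦ ?_⟩
  · refine (integral_pos_iff_support_of_nonneg hpos hint).2 ?_
    have : Function.support (fun u : ℝ ↦ (1 + u ^ 2) ^ (-(3:ℝ)/4)) = univ := by
      ext u
      simp only [Function.mem_support, mem_univ, iff_true]
      positivity
    simp [this]
  have hs : 0 < √A := Real.sqrt_pos.2 hA
  have hfun : (fun u : ℝ ↦ (A + u ^ 2) ^ (-(3:ℝ)/4)) =
      fun u ↦ A ^ (-(3:ℝ)/4) * (1 + ((√A)⁻¹ * u) ^ 2) ^ (-(3:ℝ)/4) := by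
    ext u
    rw [← Real.mul_rpow hA.le (by positivity), mul_pow, inv_pow, Real.sq_sqrt hA.le]
    congr 1
    field_simp
  have hint' : Integrable (fun u : ℝ ↦ (A + u ^ 2) ^ (-(3:ℝ)/4)) := by
    rw [hfun]
    exact (hint.comp_mul_left' (inv_ne_zero hs.ne')).const_mul _
  rw [← ofReal_integral_eq_lintegral_ofReal hint' (.of_forall fun u ↦ by positivity), hfun,
    integral_const_mul,
    Measure.integral_comp_mul_left (fun u : ℝ ↦ (1 + u ^ 2) ^ (-(3:ℝ)/4)) (√A)⁻¹,
    inv_inv, abs_of_pos hs, smul_eq_mul, ← mul_assoc, mul_comm, Real.sqrt_eq_rpow, ← Real.rpow_add hA]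
  norm_num

theorem sOne_ge_one (x : EuclideanSpace ℝ (Fin 3)) : 1 ≤ sOne x := by
  have := (le_abs_self _).trans (PiLp.norm_apply_le x 0)
  unfold sOne; linarith

theorem norm_sq_eq (x : EuclideanSpace ℝ (Fin 3)) : ‖x‖ ^ 2 = x 0 ^ 2 + x 1 ^ 2 + x 2 ^ 2 := by
  simp [EuclideanSpace.real_norm_sq_eq, Fin.sum_univ_three]

theorem abs_apply_le (x : EuclideanSpace ℝ (Fin 3)) : |x 0| ≤ ‖x‖ := PiLp.norm_apply_le x 0

theorem wakeWeight_ge_one_add_norm (x : EuclideanSpace ℝ (Fin 3)) : 1 + ‖x‖ ≤ wakeWeight x :=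
  le_mul_of_one_le_right (by positivity) (sOne_ge_one x)

theorem wakeWeight_pos (x : EuclideanSpace ℝ (Fin 3)) : 0 < wakeWeight x :=
  lt_of_lt_of_le (by positivity) (wakeWeight_ge_one_add_norm x)

theorem wakeWeight_le (x : EuclideanSpace ℝ (Fin 3)) : wakeWeight x ≤ 2 * (1 + ‖x‖) ^ 2 := by
  have := neg_le_of_abs_le (abs_apply_le x)
  have := norm_nonneg x
  unfold wakeWeight sOne
  nlinarith

theorem wakeWeight_lower (x : EuclideanSpace ℝ (Fin 3)) :
    1 + ‖x‖ + (x 1 ^ 2 + x 2 ^ 2 + min (x 0) 0 ^ 2) / 2 ≤ wakeWeight x := by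
  have h1 := norm_sq_eq x
  have h2 := abs_le.1 (abs_apply_le x)
  have h3 := norm_nonneg x
  unfold wakeWeight sOne
  rcases le_total (x 0) 0 with h | h
  · rw [min_eq_left h]; nlinarith
  · rw [min_eq_right h]; nlinarith

theorem wakeWeight_upper (x : EuclideanSpace ℝ (Fin 3)) :
    wakeWeight x ≤ 1 + 3 * ‖x‖ + 2 * (x 1 ^ 2 + x 2 ^ 2 + min (x 0) 0 ^ 2) := by
  have h1 := norm_sq_eq x
  have h2 := abs_le.1 (abs_apply_le x)
  have h3 := norm_nonneg x
  unfold wakeWeight sOne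
  rcases le_total (x 0) 0 with h | h
  · rw [min_eq_left h]; nlinarith
  · rw [min_eq_right h]; nlinarith

theorem wakeWeight_quasi_triangle (x y : EuclideanSpace ℝ (Fin 3)) :
    wakeWeight x ≤ 8 * (wakeWeight (x - y) + wakeWeight y) := by
  have hx := wakeWeight_upper x
  have hy := wakeWeight_lower y
  have hz := wakeWeight_lower (x - y)
  have hn : ‖x‖ ≤ ‖x - y‖ + ‖y‖ := by simpa using norm_add_le (x - y) y
  simp only [PiLp.sub_apply] at hz
  have hm : min (x 0) 0 ^ 2 ≤ 2 * min (x 0 - y 0) 0 ^ 2 + 2 * min (y 0) 0 ^ 2 := by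
    have h1 : min (x 0 - y 0) 0 + min (y 0) 0 ≤ min (x 0) 0 :=
      le_min (by linarith [min_le_left (x 0 - y 0) 0, min_le_left (y 0) 0])
        (by linarith [min_le_right (x 0 - y 0) 0, min_le_right (y 0) 0])
    nlinarith [min_le_right (x 0) 0, sq_nonneg (min (x 0 - y 0) 0 - min (y 0) 0)]
  have h1 : x 1 ^ 2 ≤ 2 * (x 1 - y 1) ^ 2 + 2 * y 1 ^ 2 := by
    nlinarith [sq_nonneg (x 1 - 2 * y 1)]
  have h2 : x 2 ^ 2 ≤ 2 * (x 2 - y 2) ^ 2 + 2 * y 2 ^ 2 := by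
    nlinarith [sq_nonneg (x 2 - 2 * y 2)]
  linarith [norm_nonneg (x - y), norm_nonneg y]

theorem wakeWeight_far (x y : EuclideanSpace ℝ (Fin 3)) (h : 2 * ‖x‖ ≤ ‖y‖) :
    (1 + ‖y‖) ^ 2 / 4 ≤ wakeWeight y ∨ (1 + ‖y‖) ^ 2 / 4 ≤ wakeWeight (x - y) := by
  have hn : ‖y‖ - ‖x‖ ≤ ‖x - y‖ := by rw [norm_sub_rev]; exact norm_sub_norm_le y x
  have hx := abs_le.1 (abs_apply_le x)
  have := norm_nonneg x
  have := norm_nonneg y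
  unfold wakeWeight sOne
  rcases le_total (y 0) (‖y‖ / 2) with h0 | h0
  · left; nlinarith
  · right
    simp only [PiLp.sub_apply]
    have h1 : 1 + ‖y‖ / 2 ≤ 1 + ‖x - y‖ := by linarith
    have h2 : 1 + ‖y‖ / 2 ≤ 1 + ‖x - y‖ - (x 0 - y 0) := by linarith
    nlinarith [mul_le_mul h1 h2 (by positivity) (by positivity)]

theorem lintegral_wakeWeight_le :
    ∃ K : ℝ, 0 < K ∧ ∀ g : ℝ → ℝ, Measurable g → (∀ t, 0 ≤ g t) →
      ∫⁻ z : EuclideanSpace ℝ (Fin 3), ENNReal.ofReal (g (z 0) * wakeWeight z ^ (-(3:ℝ)/2)) ≤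
        ENNReal.ofReal K * ∫⁻ t : ℝ, ENNReal.ofReal (g t * (1 + |t|) ^ (-(1:ℝ)/2)) := by
  obtain ⟨K, hK, h⟩ := lintegral_scaled_bracket_le
  refine ⟨2 ^ ((3:ℝ)/2) * K ^ 2, by positivity, fun g hg hg0 ↦ ?_⟩
  let p : ℝ → ℝ → ℝ≥0∞ := fun t u ↦ ENNReal.ofReal (((1 + |t|) + u ^ 2) ^ (-(3:ℝ)/4))
  let F : ℝ × (ℝ × ℝ) → ℝ≥0∞ := fun q ↦
    ENNReal.ofReal (2 ^ ((3:ℝ)/2)) * (ENNReal.ofReal (g q.1) * (p q.1 q.2.1 * p q.1 q.2.2))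
  have hF : Measurable F := by fun_prop
  calc ∫⁻ z : EuclideanSpace ℝ (Fin 3), ENNReal.ofReal (g (z 0) * wakeWeight z ^ (-(3:ℝ)/2))
      ≤ ∫⁻ z : EuclideanSpace ℝ (Fin 3), F (z 0, (z 1, z 2)) := by
        refine lintegral_mono fun z ↦ ?_
        simp only [F, p]
        rw [← ENNReal.ofReal_mul (by positivity), ← ENNReal.ofReal_mul (hg0 _),
          ← ENNReal.ofReal_mul (by positivity)]
        refine ENNReal.ofReal_le_ofReal ?_
        rw [mul_left_comm]
        refine mul_le_mul_of_nonneg_left ?_ (hg0 _)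
        set A := 1 + |z 0|
        have hA : 0 < A := by positivity
        have hw : (A + z 1 ^ 2 + z 2 ^ 2) / 2 ≤ wakeWeight z := by
          have := wakeWeight_lower z
          have := abs_apply_le z
          have := abs_nonneg (z 0)
          have := sq_nonneg (min (z 0) 0)
          simp only [A]
          linarith
        have e1 : ((A + z 1 ^ 2 + z 2 ^ 2) / 2) ^ (-(3:ℝ)/2) =
            2 ^ ((3:ℝ)/2) * ((A + z 1 ^ 2 + z 2 ^ 2) ^ (-(3:ℝ)/4) *
              (A + z 1 ^ 2 + z 2 ^ 2) ^ (-(3:ℝ)/4)) := by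
          rw [← Real.rpow_add (by positivity), Real.div_rpow (by positivity) (by norm_num),
            neg_div, Real.rpow_neg (x := 2) (by norm_num), div_inv_eq_mul, mul_comm]
          norm_num
        refine (Real.rpow_le_rpow_of_nonpos (by positivity) hw (by norm_num)).trans ?_
        rw [e1]
        refine mul_le_mul_of_nonneg_left ?_ (by positivity)
        refine mul_le_mul ?_ ?_ (by positivity) (by positivity)
        · exact Real.rpow_le_rpow_of_nonpos (by positivity) (by nlinarith) (by norm_num)
        · exact Real.rpow_le_rpow_of_nonpos (by positivity) (by nlinarith) (by norm_num)
    _ = ∫⁻ q, F q := measurePreserving_euclidean_three.lintegral_comp hF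
    _ = ∫⁻ t : ℝ, ∫⁻ q : ℝ × ℝ, F (t, q) := lintegral_prod _ hF.aemeasurable
    _ = ∫⁻ t : ℝ, ENNReal.ofReal (2 ^ ((3:ℝ)/2) * K ^ 2) *
          ENNReal.ofReal (g t * (1 + |t|) ^ (-(1:ℝ)/2)) := by
        refine lintegral_congr fun t ↦ ?_
        have hp : Measurable (p t) := by fun_prop
        have hA : 0 < 1 + |t| := by positivity
        simp only [F]
        rw [lintegral_const_mul _ (by fun_prop), lintegral_const_mul _ (by fun_prop)]
        have := lintegral_prod_mul (μ := (volume : Measure ℝ)) (ν := (volume : Measure ℝ))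
          hp.aemeasurable hp.aemeasurable
        rw [← Measure.volume_eq_prod] at this
        rw [this, h _ hA, ← ENNReal.ofReal_mul (by positivity), ← ENNReal.ofReal_mul (hg0 _),
          ← ENNReal.ofReal_mul (by positivity), ← ENNReal.ofReal_mul (by positivity)]
        congr 1
        have e : (1 + |t|) ^ (-(1:ℝ)/2) = (1 + |t|) ^ (-(1:ℝ)/4) * (1 + |t|) ^ (-(1:ℝ)/4) := by
          rw [← Real.rpow_add hA]; norm_num
        rw [e]; ring
    _ = _ := lintegral_const_mul _ (by fun_prop)

theorem lintegral_comp_abs_eq (f : ℝ → ℝ≥0∞) :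
    ∫⁻ t : ℝ, f |t| = 2 * ∫⁻ t in Ioi 0, f t := by
  have h1 : ∫⁻ t in Ioi (0:ℝ), f |t| = ∫⁻ t in Ioi 0, f t :=
    setLIntegral_congr_fun measurableSet_Ioi fun t ht ↦ by simp [abs_of_pos (mem_Ioi.1 ht)]
  have h2 : ∫⁻ t in Iic (0:ℝ), f |t| = ∫⁻ t in Ioi 0, f t := by
    have := (Measure.measurePreserving_neg (volume : Measure ℝ)).setLIntegral_comp_preimage_emb
      (MeasurableEquiv.neg ℝ).measurableEmbedding (fun t ↦ f |t|) (Ici (0:ℝ))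
    simp only [abs_neg, Set.neg_preimage, Set.neg_Ici, neg_zero] at this
    rw [this, setLIntegral_congr Ioi_ae_eq_Ici.symm, h1]
  rw [← lintegral_add_compl _ (measurableSet_Ioi (a := (0:ℝ))), compl_Ioi, h1, h2, two_mul]

theorem hasDerivAt_one_add_rpow {p t : ℝ} (hp : p ≠ 1) (ht : 0 < 1 + t) :
    HasDerivAt (fun t : ℝ ↦ (1 + t) ^ (1 - p) / (1 - p)) ((1 + t) ^ (-p)) t := by
  have h := (((hasDerivAt_id' t).const_add 1).rpow_const (p := 1 - p) (Or.inl ht.ne')).div_const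
    (1 - p)
  refine h.congr_deriv ?_
  have : 1 - p ≠ 0 := sub_ne_zero.2 hp.symm
  rw [show 1 - p - 1 = -p by ring]
  field_simp

theorem setLIntegral_Ioi_one_add_rpow {p R : ℝ} (hp : 1 < p) (hR : 0 ≤ R) :
    ∫⁻ t in Ioi R, ENNReal.ofReal ((1 + t) ^ (-p)) =
      ENNReal.ofReal ((1 + R) ^ (1 - p) / (p - 1)) := by
  have hd : ∀ t ∈ Ici R, HasDerivAt (fun t : ℝ ↦ (1 + t) ^ (1 - p) / (1 - p)) ((1 + t) ^ (-p)) t :=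
    fun t ht ↦ hasDerivAt_one_add_rpow hp.ne' (by linarith [mem_Ici.1 ht])
  have h0 : ∀ t ∈ Ioi R, 0 ≤ (1 + t) ^ (-p) := fun t ht ↦
    Real.rpow_nonneg (by linarith [mem_Ioi.1 ht]) _
  have hlim : Filter.Tendsto (fun t : ℝ ↦ (1 + t) ^ (1 - p) / (1 - p)) Filter.atTop (nhds 0) := by
    have h1 := (tendsto_rpow_neg_atTop (y := p - 1) (by linarith)).comp
      (Filter.tendsto_atTop_add_const_left Filter.atTop (1:ℝ) Filter.tendsto_id)
    have h2 := h1.div_const (1 - p)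
    simpa [Function.comp_def] using h2
  rw [← ofReal_integral_eq_lintegral_ofReal (integrableOn_Ioi_deriv_of_nonneg' hd h0 hlim)
    ((ae_restrict_iff' measurableSet_Ioi).2 (.of_forall h0)),
    integral_Ioi_of_hasDerivAt_of_nonneg' hd h0 hlim]
  congr 1
  have : 1 - p ≠ 0 := by linarith
  have : p - 1 ≠ 0 := by linarith
  field_simp
  ring

theorem setLIntegral_Ioc_eq_of_hasDerivAt {R : ℝ} (hR : 0 ≤ R) {f F : ℝ → ℝ}
    (hf : ContinuousOn f (Icc 0 R)) (hf0 : ∀ t ∈ Icc 0 R, 0 ≤ f t)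
    (hF : ∀ t ∈ Icc 0 R, HasDerivAt F (f t) t) :
    ∫⁻ t in Ioc 0 R, ENNReal.ofReal (f t) = ENNReal.ofReal (F R - F 0) := by
  have hi : IntervalIntegrable f volume 0 R := by
    apply ContinuousOn.intervalIntegrable
    rwa [uIcc_of_le hR]
  rw [← ofReal_integral_eq_lintegral_ofReal
    ((intervalIntegrable_iff_integrableOn_Ioc_of_le hR).1 hi)
    ((ae_restrict_iff' measurableSet_Ioc).2 (.of_forall fun t ht ↦ hf0 t (Ioc_subset_Icc_self ht))),
    ← intervalIntegral.integral_of_le hR,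
    intervalIntegral.integral_eq_sub_of_hasDerivAt (by rwa [uIcc_of_le hR]) hi]

theorem continuousOn_one_add_rpow (p R : ℝ) :
    ContinuousOn (fun t : ℝ ↦ (1 + t) ^ p) (Icc 0 R) :=
  ContinuousOn.rpow_const (by fun_prop) fun t ht ↦ Or.inl (by linarith [ht.1])

theorem setLIntegral_Ioc_one_add_rpow_le {p R : ℝ} (hp : p < 1) (hR : 0 ≤ R) :
    ∫⁻ t in Ioc 0 R, ENNReal.ofReal ((1 + t) ^ (-p)) ≤
      ENNReal.ofReal ((1 + R) ^ (1 - p) / (1 - p)) := by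
  rw [setLIntegral_Ioc_eq_of_hasDerivAt (F := fun t ↦ (1 + t) ^ (1 - p) / (1 - p)) hR
    (continuousOn_one_add_rpow _ _)]
  · refine ENNReal.ofReal_le_ofReal ?_
    have : 0 ≤ (1 + (0:ℝ)) ^ (1 - p) / (1 - p) := div_nonneg (by positivity) (by linarith)
    linarith
  · exact fun t ht ↦ Real.rpow_nonneg (by linarith [ht.1]) _
  · exact fun t ht ↦ hasDerivAt_one_add_rpow hp.ne (by linarith [ht.1])

theorem setLIntegral_Ioc_one_add_rpow_neg_one {R : ℝ} (hR : 0 ≤ R) :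
    ∫⁻ t in Ioc 0 R, ENNReal.ofReal ((1 + t) ^ (-(1:ℝ))) = ENNReal.ofReal (Real.log (1 + R)) := by
  rw [setLIntegral_Ioc_eq_of_hasDerivAt (F := fun t ↦ Real.log (1 + t)) hR
    (continuousOn_one_add_rpow _ _)]
  · simp
  · exact fun t ht ↦ Real.rpow_nonneg (by linarith [ht.1]) _
  · intro t ht
    have ht0 : 0 < 1 + t := by linarith [ht.1]
    have := ((hasDerivAt_id t).const_add 1).log ht0.ne'
    simpa [Real.rpow_neg_one] using this

/-- A majorant in the wake variable `t`: `(1+|t|)^(-b)` times `W^(-m)` for `|t| ≤ 3r`, and times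
`(1+|t|)^(-2m)` beyond. -/
noncomputable def wakeMajorant (b m W r t : ℝ) : ℝ :=
  (1 + |t|) ^ (-b) * if |t| ≤ 3 * r then W ^ (-m) else (1 + |t|) ^ (-(2 * m))

theorem measurable_wakeMajorant (b m W r : ℝ) : Measurable (wakeMajorant b m W r) := by
  unfold wakeMajorant
  refine Measurable.mul (by fun_prop) (Measurable.ite ?_ (by fun_prop) (by fun_prop))
  exact measurableSet_le (by fun_prop) (by fun_prop)

theorem wakeMajorant_nonneg (b m : ℝ) {W : ℝ} (r t : ℝ) (hW : 0 ≤ W) :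
    0 ≤ wakeMajorant b m W r t := by
  unfold wakeMajorant
  split_ifs <;> positivity

theorem rpow_neg_le_of_div_le {a k u p : ℝ} (ha : 0 < a) (hk : 0 < k) (hp : 0 ≤ p)
    (h : a / k ≤ u) : u ^ (-p) ≤ k ^ p * a ^ (-p) := by
  refine (Real.rpow_le_rpow_of_nonpos (by positivity) h (by linarith)).trans_eq ?_
  rw [Real.div_rpow ha.le hk.le, Real.rpow_neg hk.le, div_inv_eq_mul, mul_comm]

theorem rpow_neg_two_mul_le {m W r : ℝ} (hm : 0 ≤ m) (hr : 0 ≤ r) (hW : 1 ≤ W)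
    (hWr : W ≤ 2 * (1 + r) ^ 2) : (1 + r) ^ (-(2 * m)) ≤ 2 ^ m * W ^ (-m) := by
  have : (1 + r) ^ (-(2 * m)) = ((1 + r) ^ 2) ^ (-m) := by
    rw [← Real.rpow_natCast_mul (by positivity)]; congr 1; push_cast; ring
  rw [this]
  exact rpow_neg_le_of_div_le (by linarith) two_pos hm (by linarith)

theorem lintegral_wakeMajorant_le {b m : ℝ} (hm : 0 ≤ m) (hbm : 1/2 < b + 2 * m)
    {L : ℝ → ℝ} {C₁ C₂ : ℝ} (hC₁ : 0 < C₁) (hC₂ : 0 < C₂)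
    (h₁ : ∀ r, 0 ≤ r → (1 + r) ^ (1/2 - b) ≤ C₁ * L r)
    (h₂ : ∀ r, 0 ≤ r → ∫⁻ t in Ioc 0 (3 * r), ENNReal.ofReal ((1 + t) ^ (-(b + 1/2))) ≤
      ENNReal.ofReal (C₂ * L r)) :
    ∃ C : ℝ, 0 < C ∧ ∀ r W, 0 ≤ r → 1 ≤ W → W ≤ 2 * (1 + r) ^ 2 →
      ∫⁻ t : ℝ, ENNReal.ofReal (wakeMajorant b m W r t * (1 + |t|) ^ (-(1:ℝ)/2)) ≤
        ENNReal.ofReal (C * (W ^ (-m) * L r)) := by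
  have hq : 0 < b + 2 * m - 1/2 := by linarith
  refine ⟨2 * (C₂ + 2 ^ m * C₁ / (b + 2 * m - 1/2)), by positivity, fun r W hr hW hWr ↦ ?_⟩
  have hL : 0 ≤ L r := by
    have := (Real.rpow_nonneg (by linarith) _).trans (h₁ r hr)
    exact nonneg_of_mul_nonneg_right this hC₁
  let f : ℝ → ℝ≥0∞ := fun t ↦ ENNReal.ofReal
    ((1 + t) ^ (-(b + 1/2)) * if t ≤ 3 * r then W ^ (-m) else (1 + t) ^ (-(2 * m)))
  have hf : ∀ t : ℝ, ENNReal.ofReal (wakeMajorant b m W r t * (1 + |t|) ^ (-(1:ℝ)/2)) = f |t| := by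
    intro t
    have : 0 < 1 + |t| := by positivity
    simp only [f, wakeMajorant]
    rw [mul_right_comm, ← Real.rpow_add this]
    congr 3
    ring
  simp_rw [hf]
  rw [lintegral_comp_abs_eq, ← Ioc_union_Ioi_eq_Ioi (show (0:ℝ) ≤ 3 * r by positivity),
    lintegral_union measurableSet_Ioi Ioc_disjoint_Ioi_same]
  have e1 : ∫⁻ t in Ioc 0 (3 * r), f t ≤ ENNReal.ofReal (W ^ (-m) * (C₂ * L r)) := by
    calc ∫⁻ t in Ioc 0 (3 * r), f t
        = ∫⁻ t in Ioc 0 (3 * r), ENNReal.ofReal (W ^ (-m)) *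
            ENNReal.ofReal ((1 + t) ^ (-(b + 1/2))) := by
          refine setLIntegral_congr_fun measurableSet_Ioc fun t ht ↦ ?_
          simp only [f]
          rw [if_pos ht.2, ← ENNReal.ofReal_mul (by positivity), mul_comm]
      _ = ENNReal.ofReal (W ^ (-m)) *
            ∫⁻ t in Ioc 0 (3 * r), ENNReal.ofReal ((1 + t) ^ (-(b + 1/2))) :=
          lintegral_const_mul _ (by fun_prop)
      _ ≤ _ := by
          rw [ENNReal.ofReal_mul (by positivity)]
          gcongr
          exact h₂ r hr
  have e2 : ∫⁻ t in Ioi (3 * r), f t ≤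
      ENNReal.ofReal (W ^ (-m) * (2 ^ m * C₁ / (b + 2 * m - 1/2) * L r)) := by
    calc ∫⁻ t in Ioi (3 * r), f t
        = ∫⁻ t in Ioi (3 * r), ENNReal.ofReal ((1 + t) ^ (-(b + 2 * m + 1/2))) := by
          refine setLIntegral_congr_fun measurableSet_Ioi fun t ht ↦ ?_
          have ht' := mem_Ioi.1 ht
          simp only [f]
          rw [if_neg (not_le.2 ht'), ← Real.rpow_add (by linarith)]
          congr 2
          ring
      _ = _ := setLIntegral_Ioi_one_add_rpow (by linarith) (by positivity)
      _ ≤ _ := by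
          refine ENNReal.ofReal_le_ofReal ?_
          have k1 : (1 + 3 * r) ^ (1 - (b + 2 * m + 1/2)) ≤ (1 + r) ^ (1 - (b + 2 * m + 1/2)) :=
            Real.rpow_le_rpow_of_nonpos (by positivity) (by linarith) (by linarith)
          have k2 : (1 + r) ^ (1 - (b + 2 * m + 1/2)) =
              (1 + r) ^ (-(2 * m)) * (1 + r) ^ (1/2 - b) := by
            rw [← Real.rpow_add (by positivity)]; congr 1; ring
          have k3 := mul_le_mul (rpow_neg_two_mul_le hm hr hW hWr) (h₁ r hr) (by positivity)
            (by positivity)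
          rw [← k2] at k3
          rw [show b + 2 * m + 1/2 - 1 = b + 2 * m - 1/2 by ring, div_le_iff₀ hq]
          refine (k1.trans k3).trans_eq ?_
          have hq' := hq.ne'
          set q := b + 2 * m - 1/2
          field_simp
  calc 2 * ((∫⁻ t in Ioc 0 (3 * r), f t) + ∫⁻ t in Ioi (3 * r), f t)
      ≤ ENNReal.ofReal 2 * (ENNReal.ofReal (W ^ (-m) * (C₂ * L r)) +
          ENNReal.ofReal (W ^ (-m) * (2 ^ m * C₁ / (b + 2 * m - 1/2) * L r))) := by
        rw [ENNReal.ofReal_ofNat]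
        gcongr
    _ = _ := by
        rw [← ENNReal.ofReal_add (by positivity) (by positivity), ← ENNReal.ofReal_mul two_pos.le]
        congr 1
        ring

theorem one_add_norm_rpow_le_wakeMajorant {b m : ℝ} (hb : 0 ≤ b) (hm : 0 ≤ m)
    {x z : EuclideanSpace ℝ (Fin 3)} (h : ‖x‖ ≤ ‖z‖) :
    (1 + ‖z‖) ^ (-b) * (1 + ‖z‖) ^ (-(2 * m)) ≤
      2 ^ m * wakeMajorant b m (wakeWeight x) ‖x‖ (z 0) := by
  have hz := abs_apply_le z
  have hW : 1 ≤ wakeWeight x :=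
    (le_add_of_nonneg_right (norm_nonneg x)).trans (wakeWeight_ge_one_add_norm x)
  have h2 : (1:ℝ) ≤ 2 ^ m := Real.one_le_rpow one_le_two hm
  unfold wakeMajorant
  rw [mul_left_comm]
  refine mul_le_mul ?_ ?_ (by positivity) (by positivity)
  · exact Real.rpow_le_rpow_of_nonpos (by positivity) (by linarith) (by linarith)
  · split_ifs
    · exact (Real.rpow_le_rpow_of_nonpos (by positivity) (by linarith) (by linarith)).trans
        (rpow_neg_two_mul_le hm (norm_nonneg x) hW (wakeWeight_le x))
    · exact (Real.rpow_le_rpow_of_nonpos (by positivity) (by linarith) (by linarith)).trans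
        (le_mul_of_one_le_left (by positivity) h2)

theorem wakeWeight_rpow_split {b m : ℝ} (y : EuclideanSpace ℝ (Fin 3)) :
    wakeWeight y ^ (-(b + m)) =
      wakeWeight y ^ (-b) * (wakeWeight y ^ (-(3:ℝ)/2) * wakeWeight y ^ (3/2 - m)) := by
  have hy := wakeWeight_pos y
  rw [← Real.rpow_add hy, ← Real.rpow_add hy]
  congr 1
  ring

theorem kernel_le_near_left {b m : ℝ} (hb : 0 ≤ b) (hm : 0 ≤ m)
    {x y : EuclideanSpace ℝ (Fin 3)} (h : ‖y‖ ≤ 2 * ‖x‖) (hu : wakeWeight x / 16 ≤ wakeWeight y) :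
    wakeWeight y ^ (-(b + m)) ≤
      48 ^ b * 16 ^ m * wakeMajorant b m (wakeWeight x) ‖x‖ ((x - y) 0) := by
  have hW := wakeWeight_pos x
  have hr := wakeWeight_ge_one_add_norm x
  have hz := abs_apply_le (x - y)
  have hxy := norm_sub_le x y
  have e1 := rpow_neg_le_of_div_le hW (by norm_num) hm hu
  have e2 : wakeWeight y ^ (-b) ≤ 48 ^ b * (1 + |(x - y) 0|) ^ (-b) :=
    rpow_neg_le_of_div_le (by positivity) (by norm_num) hb (by linarith [norm_nonneg x])
  unfold wakeMajorant
  rw [if_pos (by linarith), neg_add, Real.rpow_add (wakeWeight_pos y)]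
  refine (mul_le_mul e2 e1 (Real.rpow_nonneg (wakeWeight_pos y).le _) (by positivity)).trans_eq ?_
  ring

theorem kernel_le_near_right {b m : ℝ} (hb : 0 ≤ b) (hm : m ≤ 3/2)
    {x y : EuclideanSpace ℝ (Fin 3)} (h : ‖y‖ ≤ 2 * ‖x‖) (hu : wakeWeight y ≤ wakeWeight x)
    (hv : wakeWeight x / 16 ≤ wakeWeight (x - y)) :
    wakeWeight (x - y) ^ (-(3:ℝ)/2) * wakeWeight y ^ (-(b + m)) ≤
      16 ^ ((3:ℝ)/2) * (wakeMajorant b m (wakeWeight x) ‖x‖ (y 0) * wakeWeight y ^ (-(3:ℝ)/2)) := by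
  have hW := wakeWeight_pos x
  have hU := wakeWeight_pos y
  have hy := abs_apply_le y
  have e1 : wakeWeight (x - y) ^ (-(3:ℝ)/2) ≤ 16 ^ ((3:ℝ)/2) * wakeWeight x ^ (-(3:ℝ)/2) := by
    rw [neg_div]
    exact rpow_neg_le_of_div_le hW (by norm_num) (by norm_num) hv
  have e2 : wakeWeight y ^ (-b) ≤ (1 + |y 0|) ^ (-b) :=
    Real.rpow_le_rpow_of_nonpos (by positivity)
      (by linarith [wakeWeight_ge_one_add_norm y]) (by linarith)
  have e3 : wakeWeight y ^ (3/2 - m) ≤ wakeWeight x ^ (3/2 - m) :=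
    Real.rpow_le_rpow hU.le hu (by linarith)
  have e4 : wakeWeight x ^ (-m) = wakeWeight x ^ (-(3:ℝ)/2) * wakeWeight x ^ (3/2 - m) := by
    rw [← Real.rpow_add hW]; congr 1; ring
  unfold wakeMajorant
  rw [if_pos (by linarith [norm_nonneg x]), wakeWeight_rpow_split, e4]
  calc _ ≤ (16 ^ ((3:ℝ)/2) * wakeWeight x ^ (-(3:ℝ)/2)) * ((1 + |y 0|) ^ (-b) *
        (wakeWeight y ^ (-(3:ℝ)/2) * wakeWeight x ^ (3/2 - m))) := by gcongr
    _ = _ := by ring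

theorem kernel_le_far_left {b m : ℝ} (hb : 0 ≤ b) (hm : 0 ≤ m)
    {x y : EuclideanSpace ℝ (Fin 3)} (h : 2 * ‖x‖ ≤ ‖y‖)
    (hu : (1 + ‖y‖) ^ 2 / 4 ≤ wakeWeight y) :
    wakeWeight y ^ (-(b + m)) ≤
      16 ^ b * 16 ^ m * 2 ^ m * wakeMajorant b m (wakeWeight x) ‖x‖ ((x - y) 0) := by
  have hxy := norm_sub_le x y
  have hn : ‖y‖ - ‖x‖ ≤ ‖x - y‖ := by rw [norm_sub_rev]; exact norm_sub_norm_le y x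
  have hz := norm_nonneg (x - y)
  have hu' : (1 + ‖x - y‖) ^ 2 / 16 ≤ wakeWeight y := by
    have : 1 + ‖x - y‖ ≤ 2 * (1 + ‖y‖) := by linarith [norm_nonneg y]
    nlinarith
  have e1 : wakeWeight y ^ (-m) ≤ 16 ^ m * (1 + ‖x - y‖) ^ (-(2 * m)) := by
    have : (1 + ‖x - y‖) ^ (-(2 * m)) = ((1 + ‖x - y‖) ^ 2) ^ (-m) := by
      rw [← Real.rpow_natCast_mul (by positivity)]; congr 1; push_cast; ring
    rw [this]
    exact rpow_neg_le_of_div_le (by positivity) (by norm_num) hm hu'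
  have e2 : wakeWeight y ^ (-b) ≤ 16 ^ b * (1 + ‖x - y‖) ^ (-b) :=
    rpow_neg_le_of_div_le (by positivity) (by norm_num) hb (by nlinarith)
  have e3 := one_add_norm_rpow_le_wakeMajorant hb hm (x := x) (z := x - y) (by linarith)
  rw [neg_add, Real.rpow_add (wakeWeight_pos y)]
  calc _ ≤ (16 ^ b * (1 + ‖x - y‖) ^ (-b)) * (16 ^ m * (1 + ‖x - y‖) ^ (-(2 * m))) :=
        mul_le_mul e2 e1 (Real.rpow_nonneg (wakeWeight_pos y).le _) (by positivity)
    _ = 16 ^ b * 16 ^ m * ((1 + ‖x - y‖) ^ (-b) * (1 + ‖x - y‖) ^ (-(2 * m))) := by ring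
    _ ≤ 16 ^ b * 16 ^ m * (2 ^ m * wakeMajorant b m (wakeWeight x) ‖x‖ ((x - y) 0)) := by gcongr
    _ = _ := by ring

theorem kernel_le_far_right {b m : ℝ} (hb : 0 ≤ b) (hm : 0 ≤ m) (hm' : m ≤ 3/2)
    {x y : EuclideanSpace ℝ (Fin 3)} (h : 2 * ‖x‖ ≤ ‖y‖)
    (hv : (1 + ‖y‖) ^ 2 / 4 ≤ wakeWeight (x - y)) :
    wakeWeight (x - y) ^ (-(3:ℝ)/2) * wakeWeight y ^ (-(b + m)) ≤
      4 ^ ((3:ℝ)/2) * 2 ^ (3/2 - m) * 2 ^ m *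
        (wakeMajorant b m (wakeWeight x) ‖x‖ (y 0) * wakeWeight y ^ (-(3:ℝ)/2)) := by
  have hU := wakeWeight_pos y
  have hsq : ∀ p : ℝ, ((1 + ‖y‖) ^ 2) ^ p = (1 + ‖y‖) ^ (2 * p) := fun p ↦ by
    rw [← Real.rpow_natCast_mul (by positivity)]; norm_num
  have e1 : wakeWeight (x - y) ^ (-(3:ℝ)/2) ≤ 4 ^ ((3:ℝ)/2) * ((1 + ‖y‖) ^ 2) ^ (-((3:ℝ)/2)) := by
    rw [neg_div]
    exact rpow_neg_le_of_div_le (by positivity) (by norm_num) (by norm_num) hv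
  have e2 : wakeWeight y ^ (-b) ≤ (1 + ‖y‖) ^ (-b) :=
    Real.rpow_le_rpow_of_nonpos (by positivity) (wakeWeight_ge_one_add_norm y) (by linarith)
  have e3 : wakeWeight y ^ (3/2 - m) ≤ 2 ^ (3/2 - m) * ((1 + ‖y‖) ^ 2) ^ (3/2 - m) := by
    rw [← Real.mul_rpow (by norm_num) (by positivity)]
    exact Real.rpow_le_rpow hU.le (wakeWeight_le y) (by linarith)
  have e4 : (1 + ‖y‖) ^ (-(2 * m)) =
      ((1 + ‖y‖) ^ 2) ^ (-((3:ℝ)/2)) * ((1 + ‖y‖) ^ 2) ^ (3/2 - m) := by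
    rw [← Real.rpow_add (by positivity), hsq]; congr 1; ring
  have e5 := one_add_norm_rpow_le_wakeMajorant hb hm (x := x) (z := y)
    (by linarith [norm_nonneg x])
  rw [e4] at e5
  rw [wakeWeight_rpow_split]
  calc _ ≤ (4 ^ ((3:ℝ)/2) * ((1 + ‖y‖) ^ 2) ^ (-((3:ℝ)/2))) * ((1 + ‖y‖) ^ (-b) *
        (wakeWeight y ^ (-(3:ℝ)/2) * (2 ^ (3/2 - m) * ((1 + ‖y‖) ^ 2) ^ (3/2 - m)))) := by gcongr
    _ = 4 ^ ((3:ℝ)/2) * 2 ^ (3/2 - m) * ((1 + ‖y‖) ^ (-b) * (((1 + ‖y‖) ^ 2) ^ (-((3:ℝ)/2)) *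
        ((1 + ‖y‖) ^ 2) ^ (3/2 - m))) * wakeWeight y ^ (-(3:ℝ)/2) := by ring
    _ ≤ 4 ^ ((3:ℝ)/2) * 2 ^ (3/2 - m) * (2 ^ m * wakeMajorant b m (wakeWeight x) ‖x‖ (y 0)) *
        wakeWeight y ^ (-(3:ℝ)/2) := by gcongr
    _ = _ := by ring

theorem exists_kernel_le {b m : ℝ} (hb : 0 ≤ b) (hm : 0 ≤ m) (hm' : m ≤ 3/2) :
    ∃ C : ℝ, 0 < C ∧ ∀ x y : EuclideanSpace ℝ (Fin 3),
      wakeWeight (x - y) ^ (-(3:ℝ)/2) * wakeWeight y ^ (-(b + m)) ≤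
        C * (wakeMajorant b m (wakeWeight x) ‖x‖ ((x - y) 0) * wakeWeight (x - y) ^ (-(3:ℝ)/2) +
          wakeMajorant b m (wakeWeight x) ‖x‖ (y 0) * wakeWeight y ^ (-(3:ℝ)/2)) := by
  refine ⟨48 ^ b * 16 ^ m + 16 ^ ((3:ℝ)/2) + 16 ^ b * 16 ^ m * 2 ^ m +
    4 ^ ((3:ℝ)/2) * 2 ^ (3/2 - m) * 2 ^ m, by positivity, fun x y ↦ ?_⟩
  have hv0 := Real.rpow_nonneg (wakeWeight_pos (x - y)).le (-(3:ℝ)/2)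
  have hu0 := Real.rpow_nonneg (wakeWeight_pos y).le (-(3:ℝ)/2)
  set P := wakeMajorant b m (wakeWeight x) ‖x‖ ((x - y) 0) * wakeWeight (x - y) ^ (-(3:ℝ)/2)
    with hPdef
  set Q := wakeMajorant b m (wakeWeight x) ‖x‖ (y 0) * wakeWeight y ^ (-(3:ℝ)/2)
  have hP : 0 ≤ P := mul_nonneg (wakeMajorant_nonneg _ _ _ _ (wakeWeight_pos x).le) hv0
  have hQ : 0 ≤ Q := mul_nonneg (wakeMajorant_nonneg _ _ _ _ (wakeWeight_pos x).le) hu0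
  set c₁ : ℝ := 48 ^ b * 16 ^ m with hc₁
  set c₂ : ℝ := 16 ^ ((3:ℝ)/2) with hc₂
  set c₃ : ℝ := 16 ^ b * 16 ^ m * 2 ^ m with hc₃
  set c₄ : ℝ := 4 ^ ((3:ℝ)/2) * 2 ^ (3/2 - m) * 2 ^ m with hc₄
  have p₁ : 0 ≤ c₁ := by positivity
  have p₂ : 0 ≤ c₂ := by positivity
  have p₃ : 0 ≤ c₃ := by positivity
  have p₄ : 0 ≤ c₄ := by positivity
  have left : ∀ c : ℝ, 0 ≤ c → c ≤ c₁ + c₂ + c₃ + c₄ →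
      wakeWeight y ^ (-(b + m)) ≤ c * wakeMajorant b m (wakeWeight x) ‖x‖ ((x - y) 0) →
      wakeWeight (x - y) ^ (-(3:ℝ)/2) * wakeWeight y ^ (-(b + m)) ≤
        (c₁ + c₂ + c₃ + c₄) * (P + Q) := fun c hc0 hc h ↦ by
    calc _ ≤ wakeWeight (x - y) ^ (-(3:ℝ)/2) *
          (c * wakeMajorant b m (wakeWeight x) ‖x‖ ((x - y) 0)) := by gcongr
      _ = c * P := by rw [hPdef]; ring
      _ ≤ _ := mul_le_mul hc (by linarith) hP (by linarith)
  have right : ∀ c : ℝ, c ≤ c₁ + c₂ + c₃ + c₄ →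
      wakeWeight (x - y) ^ (-(3:ℝ)/2) * wakeWeight y ^ (-(b + m)) ≤ c * Q →
      wakeWeight (x - y) ^ (-(3:ℝ)/2) * wakeWeight y ^ (-(b + m)) ≤
        (c₁ + c₂ + c₃ + c₄) * (P + Q) := fun c hc h ↦
    h.trans (mul_le_mul hc (by linarith) hQ (by linarith))
  rcases le_total ‖y‖ (2 * ‖x‖) with h | h
  · rcases le_total (wakeWeight x / 16) (wakeWeight y) with hu | hu
    · exact left c₁ p₁ (by linarith) (kernel_le_near_left hb hm h hu)
    · have hq := wakeWeight_quasi_triangle x y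
      have hW := wakeWeight_pos x
      exact right c₂ (by linarith)
        (kernel_le_near_right hb hm' h (by linarith) (by linarith))
  · rcases wakeWeight_far x y h with hu | hv
    · exact left c₃ p₃ (by linarith) (kernel_le_far_left hb hm h hu)
    · exact right c₄ (by linarith) (kernel_le_far_right hb hm hm' h hv)

theorem convolution_le_of_growth {b m : ℝ} (hb : 0 ≤ b) (hm : 0 ≤ m) (hm' : m ≤ 3/2)
    (hbm : 1/2 < b + 2 * m) {L : ℝ → ℝ} {C₁ C₂ : ℝ} (hC₁ : 0 < C₁) (hC₂ : 0 < C₂)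
    (h₁ : ∀ r, 0 ≤ r → (1 + r) ^ (1/2 - b) ≤ C₁ * L r)
    (h₂ : ∀ r, 0 ≤ r → ∫⁻ t in Ioc 0 (3 * r), ENNReal.ofReal ((1 + t) ^ (-(b + 1/2))) ≤
      ENNReal.ofReal (C₂ * L r)) :
    ∃ C : ℝ, 0 < C ∧ ∀ x : EuclideanSpace ℝ (Fin 3),
      (∫ y, wakeWeight (x - y) ^ (-(3:ℝ)/2) * wakeWeight y ^ (-(b + m))) ≤
        C * (wakeWeight x ^ (-m) * L ‖x‖) := by
  obtain ⟨A, hA, hker⟩ := exists_kernel_le hb hm hm'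
  obtain ⟨K, hK, hint⟩ := lintegral_wakeWeight_le
  obtain ⟨B, hB, hmaj⟩ := lintegral_wakeMajorant_le hm hbm hC₁ hC₂ h₁ h₂
  refine ⟨2 * A * K * B, by positivity, fun x ↦ ?_⟩
  have hL : 0 ≤ L ‖x‖ := by
    have := (Real.rpow_nonneg (by positivity) _).trans (h₁ ‖x‖ (norm_nonneg x))
    exact nonneg_of_mul_nonneg_right this hC₁
  have hx := wakeWeight_pos x
  have hW : 1 ≤ wakeWeight x :=
    (le_add_of_nonneg_right (norm_nonneg x)).trans (wakeWeight_ge_one_add_norm x)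
  have hmeas : Measurable wakeWeight := by
    unfold wakeWeight sOne
    fun_prop
  set g := wakeMajorant b m (wakeWeight x) ‖x‖
  have hg : Measurable g := measurable_wakeMajorant _ _ _ _
  have hg0 : ∀ t, 0 ≤ g t := fun t ↦ wakeMajorant_nonneg _ _ _ _ hx.le
  let φ : EuclideanSpace ℝ (Fin 3) → ℝ≥0∞ := fun z ↦
    ENNReal.ofReal (g (z 0) * wakeWeight z ^ (-(3:ℝ)/2))
  have hφ : Measurable φ := by fun_prop
  have hφle : ∫⁻ z, φ z ≤ ENNReal.ofReal (K * (B * (wakeWeight x ^ (-m) * L ‖x‖))) := by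
    rw [ENNReal.ofReal_mul hK.le]
    refine (hint g hg hg0).trans ?_
    gcongr
    exact hmaj _ _ (norm_nonneg x) hW (wakeWeight_le x)
  have hnn : ∀ (z : EuclideanSpace ℝ (Fin 3)) (p : ℝ), 0 ≤ wakeWeight z ^ p :=
    fun z p ↦ Real.rpow_nonneg (wakeWeight_pos z).le p
  rw [integral_eq_lintegral_of_nonneg_ae (.of_forall fun y ↦ mul_nonneg (hnn _ _) (hnn _ _))
    (Measurable.aestronglyMeasurable (by fun_prop))]
  refine ENNReal.toReal_le_of_le_ofReal (by positivity) ?_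
  calc ∫⁻ y, ENNReal.ofReal (wakeWeight (x - y) ^ (-(3:ℝ)/2) * wakeWeight y ^ (-(b + m)))
      ≤ ∫⁻ y, ENNReal.ofReal A * (φ (x - y) + φ y) := by
        refine lintegral_mono fun y ↦ ?_
        simp only [φ]
        rw [← ENNReal.ofReal_add (mul_nonneg (hg0 _) (hnn _ _)) (mul_nonneg (hg0 _) (hnn _ _)),
          ← ENNReal.ofReal_mul hA.le]
        exact ENNReal.ofReal_le_ofReal (hker x y)
    _ = ENNReal.ofReal A * ((∫⁻ y, φ y) + ∫⁻ y, φ y) := by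
        rw [lintegral_const_mul _ (by fun_prop), lintegral_add_right _ hφ,
          lintegral_sub_left_eq_self φ x]
    _ ≤ ENNReal.ofReal A * (ENNReal.ofReal (K * (B * (wakeWeight x ^ (-m) * L ‖x‖))) +
          ENNReal.ofReal (K * (B * (wakeWeight x ^ (-m) * L ‖x‖)))) := by gcongr
    _ = _ := by
        have := hnn x (-m)
        rw [← ENNReal.ofReal_add (by positivity) (by positivity), ← ENNReal.ofReal_mul hA.le]
        congr 1
        ring

theorem convolution_anisotropic_weights (γ : ℝ) (hγ : 1/4 < γ)
    (c d : ℝ) (k : ℕ)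
    (hc : c = if γ ≤ 2 then γ - 1/2 else 3/2)
    (hd : d = if γ ≤ 3/2 then γ else 3/2)
    (hk : k = if γ = 2 then 1 else 0) :
    ∃ C : ℝ, 0 < C ∧ ∀ x : EuclideanSpace ℝ (Fin 3),
      (∫ y : EuclideanSpace ℝ (Fin 3),
          ((1 + ‖x - y‖) * sOne (x - y)) ^ (-(3:ℝ)/2) * ((1 + ‖y‖) * sOne y) ^ (-γ))
        ≤ C * (1 + ‖x‖) ^ (-c) * (sOne x) ^ (-d) * (Real.log (2 + ‖x‖)) ^ k := by
  have hb : 0 ≤ γ - d := by split_ifs at hd <;> linarith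
  have hd0 : 0 ≤ d := by split_ifs at hd <;> linarith
  have hd' : d ≤ 3/2 := by split_ifs at hd <;> linarith
  have hbd : 1/2 < γ - d + 2 * d := by split_ifs at hd <;> linarith
  have growth : ∃ C₁ C₂ : ℝ, 0 < C₁ ∧ 0 < C₂ ∧
      (∀ r : ℝ, 0 ≤ r →
        (1 + r) ^ (1/2 - (γ - d)) ≤ C₁ * ((1 + r) ^ (d - c) * Real.log (2 + r) ^ k)) ∧
      ∀ r : ℝ, 0 ≤ r → ∫⁻ t in Ioc 0 (3 * r), ENNReal.ofReal ((1 + t) ^ (-(γ - d + 1/2))) ≤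
        ENNReal.ofReal (C₂ * ((1 + r) ^ (d - c) * Real.log (2 + r) ^ k)) := by
    rcases lt_trichotomy γ 2 with h | h | h
    · rw [if_pos h.le] at hc
      rw [if_neg h.ne] at hk
      have hp : γ - d < 1/2 := by split_ifs at hd <;> linarith
      have he : d - c = 1/2 - (γ - d) := by rw [hc]; ring
      refine ⟨1, 3 ^ (1/2 - (γ - d)) / (1/2 - (γ - d)), one_pos,
        div_pos (by positivity) (by linarith), fun r hr ↦ ?_, fun r hr ↦ ?_⟩
      · rw [he, hk]; simp
      · refine (setLIntegral_Ioc_one_add_rpow_le (by linarith) (by positivity)).trans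
          (ENNReal.ofReal_le_ofReal ?_)
        rw [he, hk, pow_zero, mul_one, div_mul_eq_mul_div, ← Real.mul_rpow (by norm_num)
          (by positivity), show 1 - (γ - d + 1/2) = 1/2 - (γ - d) by ring]
        refine div_le_div_of_nonneg_right ?_ (by linarith)
        exact Real.rpow_le_rpow (by positivity) (by linarith) (by linarith)
    · have hd2 : d = 3/2 := by rw [hd, if_neg (by linarith)]
      have hc2 : c = 3/2 := by rw [hc, if_pos h.le, h]; norm_num
      rw [if_pos h] at hk
      have hl2 : 0 < Real.log 2 := Real.log_pos one_lt_two
      refine ⟨(Real.log 2)⁻¹, 3, by positivity, by norm_num, fun r hr ↦ ?_, fun r hr ↦ ?_⟩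
      · rw [hd2, hc2, h, hk]
        norm_num
        rw [← div_eq_inv_mul, one_le_div hl2]
        exact Real.log_le_log two_pos (by linarith)
      · rw [hd2, hc2, h, hk, show (2 - 3/2 + 1/2 : ℝ) = 1 by norm_num,
          setLIntegral_Ioc_one_add_rpow_neg_one (by positivity)]
        refine ENNReal.ofReal_le_ofReal ?_
        rw [sub_self, Real.rpow_zero, one_mul, pow_one]
        have : (3:ℝ) * Real.log (2 + r) = Real.log ((2 + r) ^ 3) := by
          rw [Real.log_pow]; norm_num
        rw [this]
        exact Real.log_le_log (by positivity) (by nlinarith [pow_nonneg hr 3])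
    · have hd2 : d = 3/2 := by rw [hd, if_neg (by linarith)]
      have hc2 : c = 3/2 := by rw [hc, if_neg (by linarith)]
      rw [if_neg h.ne'] at hk
      refine ⟨1, (γ - 2)⁻¹, one_pos, inv_pos.2 (by linarith), fun r hr ↦ ?_, fun r hr ↦ ?_⟩
      · rw [hd2, hc2, hk]
        simpa using Real.rpow_le_one_of_one_le_of_nonpos (x := 1 + r) (by linarith)
          (show 2⁻¹ - (γ - 3/2) ≤ 0 by linarith)
      · refine (lintegral_mono_set Ioc_subset_Ioi_self).trans ?_
        rw [setLIntegral_Ioi_one_add_rpow (by linarith) le_rfl, hd2, hc2, hk]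
        refine ENNReal.ofReal_le_ofReal ?_
        rw [add_zero, Real.one_rpow, show γ - 3/2 + 1/2 - 1 = γ - 2 by ring]
        simp
  obtain ⟨C₁, C₂, hC₁, hC₂, h₁, h₂⟩ := growth
  obtain ⟨C, hC, h⟩ := convolution_le_of_growth hb hd0 hd' hbd hC₁ hC₂ h₁ h₂
  refine ⟨C, hC, fun x ↦ ?_⟩
  have hx := h x
  rw [sub_add_cancel] at hx
  refine hx.trans_eq ?_
  have hs : 0 < sOne x := one_pos.trans_le (sOne_ge_one x)
  rw [wakeWeight, Real.mul_rpow (by positivity) hs.le,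
    show -c = -d + (d - c) by ring, Real.rpow_add (by positivity)]
  ring
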